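/- arXiv:2203.05690 — 3 statements merged into one kernel-verified Lean document; each statement's English description precedes it below -/
import Mathlib

section
/- For every natural number n, the following identity of formal power series in z and q holds: ∑_{k=0}^{n} z^k q^{k²} [n choose k]_q / (zq²;q)_k = (1 + zq − zq^{n+1})/(zq²;q)_n = (1 − zq^{n+1} − z²q²(1−q^n))/(zq;q)_{n+1}. Equivalently, after clearing denominators, ∑_{k=0}^{n} z^k q^{k²} [n choose k]_q (zq^{2+k};q)_{n−k} = 1 + zq − zq^{n+1} as polynomials in z and q. -/
noncomputable section

/-- The ring of formal power series `ℚ[[z,q]]`. -/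
abbrev R2 : Type := MvPowerSeries (Fin 2) ℚ

/-- The variable `z`. -/
def Z : R2 := MvPowerSeries.X 0
/-- The variable `q`. -/
def Q : R2 := MvPowerSeries.X 1

/-- The q-Pochhammer symbol `(a;q)_n = ∏_{t=0}^{n-1} (1 - a q^t)`. -/
def poch (a : R2) (n : ℕ) : R2 := ∏ t ∈ Finset.range n, (1 - a * Q ^ t)

/-- `(q;q)_n`. -/
def qp (n : ℕ) : R2 := poch Q n

/-- The Gaussian binomial coefficient `[n choose k]_q = (q;q)_n / ((q;q)_k (q;q)_{n-k})`
for `0 ≤ k ≤ n`, and `0` otherwise. -/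
def gbinom (n k : ℕ) : R2 := if k ≤ n then qp n * (qp k * qp (n - k))⁻¹ else 0

lemma constantCoeff_Q : MvPowerSeries.constantCoeff Q = (0 : ℚ) :=
  MvPowerSeries.constantCoeff_X 1

lemma constantCoeff_Z : MvPowerSeries.constantCoeff Z = (0 : ℚ) :=
  MvPowerSeries.constantCoeff_X 0

lemma constantCoeff_poch {a : R2} (ha : MvPowerSeries.constantCoeff a = 0) (n : ℕ) :
    MvPowerSeries.constantCoeff (poch a n) = 1 := by
  simp [poch, map_prod, ha]

lemma poch_mul_inv {a : R2} (ha : MvPowerSeries.constantCoeff a = 0) (n : ℕ) :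
    poch a n * (poch a n)⁻¹ = 1 :=
  MvPowerSeries.mul_inv_cancel _ (by rw [constantCoeff_poch ha]; exact one_ne_zero)

lemma poch_ne_zero {a : R2} (ha : MvPowerSeries.constantCoeff a = 0) (n : ℕ) : poch a n ≠ 0 :=
  left_ne_zero_of_mul_eq_one (poch_mul_inv ha n)

lemma poch_zero (a : R2) : poch a 0 = 1 := by simp [poch]

lemma poch_succ (a : R2) (n : ℕ) : poch a (n + 1) = poch a n * (1 - a * Q ^ n) := by
  simp [poch, Finset.prod_range_succ]

lemma poch_add (a : R2) (m n : ℕ) : poch a (m + n) = poch a m * poch (a * Q ^ m) n := by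
  simp only [poch, Finset.prod_range_add]
  congr 1
  refine Finset.prod_congr rfl fun t _ => ?_
  ring

lemma qp_succ (n : ℕ) : qp (n + 1) = qp n * (1 - Q ^ (n + 1)) := by
  rw [qp, poch_succ, ← qp]; ring

lemma qp_ne_zero (n : ℕ) : qp n ≠ 0 := poch_ne_zero constantCoeff_Q n

lemma gbinom_add_mul (k m : ℕ) : gbinom (k + m) k * (qp k * qp m) = qp (k + m) := by
  have h : MvPowerSeries.constantCoeff (qp k * qp m) ≠ (0 : ℚ) := by
    simp [qp, constantCoeff_poch constantCoeff_Q]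
  rw [gbinom, if_pos (Nat.le_add_right k m), Nat.add_sub_cancel_left, mul_assoc,
    MvPowerSeries.inv_mul_cancel _ h, mul_one]

lemma gbinom_eq_zero {n k : ℕ} (h : n < k) : gbinom n k = 0 := if_neg (not_le.mpr h)

lemma gbinom_zero_right (n : ℕ) : gbinom n 0 = 1 := by
  have h := gbinom_add_mul 0 n
  rw [zero_add, show qp 0 = 1 from poch_zero Q, one_mul] at h
  exact mul_right_cancel₀ (qp_ne_zero n) (h.trans (one_mul _).symm)

lemma gbinom_self (n : ℕ) : gbinom n n = 1 := by
  have h := gbinom_add_mul n 0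
  rw [add_zero, show qp 0 = 1 from poch_zero Q, mul_one] at h
  exact mul_right_cancel₀ (qp_ne_zero n) (h.trans (one_mul _).symm)

/-- Absorption: `(1 - q^{k+1}) [n+1 choose k+1] = (1 - q^{n+1}) [n choose k]`. -/
lemma one_sub_mul_gbinom_succ_succ {n k : ℕ} (h : k ≤ n) :
    (1 - Q ^ (k + 1)) * gbinom (n + 1) (k + 1) = (1 - Q ^ (n + 1)) * gbinom n k := by
  obtain ⟨m, rfl⟩ := Nat.exists_eq_add_of_le h
  have h₁ := gbinom_add_mul (k + 1) m
  have h₂ := gbinom_add_mul k m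
  rw [show k + 1 + m = k + m + 1 by ring, qp_succ, qp_succ] at h₁
  refine mul_right_cancel₀ (mul_ne_zero (qp_ne_zero k) (qp_ne_zero m)) ?_
  linear_combination h₁ - (1 - Q ^ (k + m + 1)) * h₂

/-- The `q`-Pascal rule. -/
lemma gbinom_succ_succ {n k : ℕ} (h : k ≤ n) :
    gbinom (n + 1) (k + 1) = gbinom n (k + 1) + Q ^ (n - k) * gbinom n k := by
  obtain ⟨m, rfl⟩ := Nat.exists_eq_add_of_le h
  rcases m with _ | m
  · simp [gbinom_self, gbinom_eq_zero]
  have h₁ := gbinom_add_mul (k + 1) (m + 1)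
  have h₂ := gbinom_add_mul (k + 1) m
  have h₃ := gbinom_add_mul k (m + 1)
  rw [show k + 1 + (m + 1) = k + (m + 1) + 1 by ring, qp_succ (k + (m + 1)), qp_succ k,
    qp_succ m] at h₁
  rw [show k + 1 + m = k + (m + 1) by ring, qp_succ k] at h₂
  rw [qp_succ m] at h₃
  rw [Nat.add_sub_cancel_left]
  have hne := mul_ne_zero (qp_ne_zero (k + 1)) (qp_ne_zero (m + 1))
  rw [qp_succ, qp_succ] at hne
  refine mul_right_cancel₀ hne ?_
  linear_combination h₁ - (1 - Q ^ (m + 1)) * h₂ - Q ^ (m + 1) * (1 - Q ^ (k + 1)) * h₃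

/-- `∑_k x^k q^{k²} [n choose k] (x q^{k+1};q)_{n-k} = 1`. -/
lemma sum_gbinom_mul_poch (n : ℕ) (x : R2) :
    ∑ k ∈ Finset.range (n + 1),
      x ^ k * Q ^ (k ^ 2) * gbinom n k * poch (x * Q ^ (k + 1)) (n - k) = 1 := by
  induction n generalizing x with
  | zero => simp [gbinom_zero_right, poch_zero]
  | succ n ih =>
    have hsplit : ∀ k ∈ Finset.range (n + 1),
        x ^ (k + 1) * Q ^ ((k + 1) ^ 2) * gbinom (n + 1) (k + 1) *
            poch (x * Q ^ (k + 1 + 1)) (n + 1 - (k + 1)) =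
          x ^ (k + 1) * Q ^ ((k + 1) ^ 2) * gbinom n (k + 1) *
            poch (x * Q ^ (k + 1 + 1)) (n + 1 - (k + 1)) +
          x * Q ^ (n + 1) * ((x * Q) ^ k * Q ^ (k ^ 2) * gbinom n k *
            poch (x * Q * Q ^ (k + 1)) (n - k)) := by
      intro k hk
      have hk : k ≤ n := Nat.lt_succ_iff.mp (Finset.mem_range.mp hk)
      rw [gbinom_succ_succ hk, Nat.add_sub_add_right,
        show x * Q * Q ^ (k + 1) = x * Q ^ (k + 1 + 1) by ring]
      obtain ⟨m, rfl⟩ := Nat.exists_eq_add_of_le hk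
      rw [Nat.add_sub_cancel_left]
      ring
    have hlast : ∀ k ∈ Finset.range (n + 1),
        x ^ k * Q ^ (k ^ 2) * gbinom n k * poch (x * Q ^ (k + 1)) (n + 1 - k) =
          (1 - x * Q ^ (n + 1)) *
            (x ^ k * Q ^ (k ^ 2) * gbinom n k * poch (x * Q ^ (k + 1)) (n - k)) := by
      intro k hk
      have hk : k ≤ n := Nat.lt_succ_iff.mp (Finset.mem_range.mp hk)
      obtain ⟨m, rfl⟩ := Nat.exists_eq_add_of_le hk
      rw [add_assoc, Nat.add_sub_cancel_left, Nat.add_sub_cancel_left, poch_succ]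
      ring
    have hfirst := Finset.sum_range_succ' (fun k =>
      x ^ k * Q ^ (k ^ 2) * gbinom n k * poch (x * Q ^ (k + 1)) (n + 1 - k)) (n + 1)
    rw [Finset.sum_range_succ, Finset.sum_congr rfl hlast, ← Finset.mul_sum, ih x,
      gbinom_eq_zero (Nat.lt_succ_self n), gbinom_zero_right] at hfirst
    rw [Finset.sum_range_succ', Finset.sum_congr rfl hsplit, Finset.sum_add_distrib,
      ← Finset.mul_sum, ih (x * Q), gbinom_zero_right]
    linear_combination -hfirst

/-- The denominator-cleared identity
`∑_k z^k q^{k²} [n choose k] (z q^{2+k};q)_{n-k} = 1 + z q - z q^{n+1}`. -/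
lemma sum_gbinom_mul_poch_shift (n : ℕ) (z : R2) :
    ∑ k ∈ Finset.range (n + 1),
      z ^ k * Q ^ (k ^ 2) * gbinom n k * poch (z * Q ^ (2 + k)) (n - k) =
        1 + z * Q - z * Q ^ (n + 1) := by
  rcases n with _ | n
  · simp [gbinom_zero_right, poch_zero]
  have hstep : ∀ k ∈ Finset.range (n + 1),
      z ^ (k + 1) * Q ^ ((k + 1) ^ 2) * gbinom (n + 1) (k + 1) *
          poch (z * Q ^ (2 + (k + 1))) (n + 1 - (k + 1)) =
        (z * Q) ^ (k + 1) * Q ^ ((k + 1) ^ 2) * gbinom (n + 1) (k + 1) *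
          poch (z * Q * Q ^ (k + 1 + 1)) (n + 1 - (k + 1)) +
        z * Q * (1 - Q ^ (n + 1)) * ((z * Q ^ 2) ^ k * Q ^ (k ^ 2) * gbinom n k *
          poch (z * Q ^ 2 * Q ^ (k + 1)) (n - k)) := by
    intro k hk
    have hk : k ≤ n := Nat.lt_succ_iff.mp (Finset.mem_range.mp hk)
    rw [Nat.add_sub_add_right, show z * Q * Q ^ (k + 1 + 1) = z * Q ^ (2 + (k + 1)) by ring,
      show z * Q ^ 2 * Q ^ (k + 1) = z * Q ^ (2 + (k + 1)) by ring]
    linear_combination z ^ (k + 1) * Q ^ ((k + 1) ^ 2) * poch (z * Q ^ (2 + (k + 1))) (n - k) *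
      one_sub_mul_gbinom_succ_succ hk
  have hone := sum_gbinom_mul_poch (n + 1) (z * Q)
  rw [Finset.sum_range_succ', gbinom_zero_right] at hone
  rw [Finset.sum_range_succ', Finset.sum_congr rfl hstep, Finset.sum_add_distrib,
    ← Finset.mul_sum, sum_gbinom_mul_poch, gbinom_zero_right,
    show z * Q ^ (2 + 0) = z * Q * Q ^ (0 + 1) by ring]
  linear_combination hone

/-- Lemma `lem:bincoeff`:
`∑_{k=0}^{n} z^k q^{k²} [n choose k]_q / (zq²;q)_k = (1 + zq − zq^{n+1})/(zq²;q)_n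
  = (1 − zq^{n+1} − z²q²(1−q^n))/(zq;q)_{n+1}`,
together with the denominator-cleared polynomial form
`∑_{k=0}^{n} z^k q^{k²} [n choose k]_q (zq^{2+k};q)_{n−k} = 1 + zq − zq^{n+1}`. -/
theorem statement0 (n : ℕ) :
    (∑ k ∈ Finset.range (n + 1),
        Z ^ k * Q ^ (k ^ 2) * gbinom n k * (poch (Z * Q ^ 2) k)⁻¹)
      = (1 + Z * Q - Z * Q ^ (n + 1)) * (poch (Z * Q ^ 2) n)⁻¹ ∧
    (1 + Z * Q - Z * Q ^ (n + 1)) * (poch (Z * Q ^ 2) n)⁻¹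
      = (1 - Z * Q ^ (n + 1) - Z ^ 2 * Q ^ 2 * (1 - Q ^ n)) * (poch (Z * Q) (n + 1))⁻¹ ∧
    (∑ k ∈ Finset.range (n + 1),
        Z ^ k * Q ^ (k ^ 2) * gbinom n k * poch (Z * Q ^ (2 + k)) (n - k))
      = 1 + Z * Q - Z * Q ^ (n + 1) := by
  have hZ (m : ℕ) : MvPowerSeries.constantCoeff (Z * Q ^ m) = (0 : ℚ) := by
    simp [constantCoeff_Z]
  have hZQ : MvPowerSeries.constantCoeff (Z * Q) = (0 : ℚ) := by simp [constantCoeff_Z]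
  have hn := poch_mul_inv (hZ 2) n
  refine ⟨?_, ?_, sum_gbinom_mul_poch_shift n Z⟩
  · rw [← sum_gbinom_mul_poch_shift n Z, Finset.sum_mul]
    refine Finset.sum_congr rfl fun k hk => ?_
    obtain ⟨m, rfl⟩ := Nat.exists_eq_add_of_le (Nat.lt_succ_iff.mp (Finset.mem_range.mp hk))
    have hk := poch_mul_inv (hZ 2) k
    have hadd := poch_add (Z * Q ^ 2) k m
    rw [Nat.add_sub_cancel_left, show Z * Q ^ (2 + k) = Z * Q ^ 2 * Q ^ k by ring,
      mul_assoc _ (poch (Z * Q ^ 2 * Q ^ k) m)]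
    congr 1
    refine mul_left_cancel₀ (poch_ne_zero (hZ 2) (k + m)) ?_
    linear_combination (poch (Z * Q ^ 2) k)⁻¹ * hadd +
      poch (Z * Q ^ 2 * Q ^ k) m * hk - poch (Z * Q ^ 2 * Q ^ k) m * hn
  · have hinv := poch_mul_inv hZQ (n + 1)
    have hadd := poch_add (Z * Q) 1 n
    rw [show Z * Q * Q ^ 1 = Z * Q ^ 2 by ring, poch_succ, poch_zero, add_comm 1 n] at hadd
    refine mul_left_cancel₀ (poch_ne_zero hZQ (n + 1)) ?_
    linear_combination (1 + Z * Q - Z * Q ^ (n + 1)) * (poch (Z * Q ^ 2) n)⁻¹ * hadd +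
      (1 + Z * Q - Z * Q ^ (n + 1)) * (1 - Z * Q) * hn -
      (1 - Z * Q ^ (n + 1) - Z ^ 2 * Q ^ 2 * (1 - Q ^ n)) * hinv
end
end

section
/- Let k ≥ 1, 1 ≤ t ≤ k+1 and n₀ ∈ ℕ. Then the following identity of formal power series in q holds: ∑_{n₀ ≥ n₁ ≥ ⋯ ≥ n_k ≥ 0} q^{n₁²+⋯+n_k² + n_t + n_{t+1} + ⋯ + n_k} [n₀ choose n₁]_q [n₁ choose n₂]_q ⋯ [n_{k−1} choose n_k]_q / (q²;q)_{n_k} = (1 − q^t − q^{n₀+1}(1 − q^{t−1})) / (q;q)_{n₀+1}, where the sum is over weakly decreasing chains n₀ ≥ n₁ ≥ ⋯ ≥ n_k ≥ 0 of natural numbers and the linear term n_t + ⋯ + n_k in the exponent is empty (zero) when t = k+1. -/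
noncomputable section

open PowerSeries

/-- The q-Pochhammer symbol `(q^j;q)_n = ∏_{t=0}^{n-1} (1 - q^{j+t})` in `ℚ[[q]]`. -/
def pochN (j n : ℕ) : PowerSeries ℚ :=
  ∏ t ∈ Finset.range n, (1 - (X : PowerSeries ℚ) ^ (j + t))

/-- The Gaussian binomial coefficient `[n choose k]_q = (q;q)_n / ((q;q)_k (q;q)_{n-k})`
for `0 ≤ k ≤ n`, and `0` otherwise. -/
def gbinomQ (n k : ℕ) : PowerSeries ℚ :=
  if k ≤ n then pochN 1 n * (pochN 1 k * pochN 1 (n - k))⁻¹ else 0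

lemma pochN_one_succ (n : ℕ) : pochN 1 (n + 1) = pochN 1 n * (1 - X ^ (n + 1)) := by
  rw [pochN, Finset.prod_range_succ, ← pochN, add_comm 1 n]

lemma pochN_one_succ' (n : ℕ) : pochN 1 (n + 1) = (1 - X) * pochN 2 n := by
  rw [pochN, Finset.prod_range_succ', mul_comm, pochN]
  congr 1
  · simp
  · exact Finset.prod_congr rfl fun i _ ↦ by ring

lemma constantCoeff_pochN_succ (j n : ℕ) : constantCoeff (pochN (j + 1) n) = 1 := by
  simp [pochN, map_prod]

lemma pochN_one_mul_inv (n : ℕ) : pochN 1 n * (pochN 1 n)⁻¹ = 1 :=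
  PowerSeries.mul_inv_cancel _ (by simp [constantCoeff_pochN_succ 0 n])

lemma constantCoeff_one_sub_X_pow_succ (n : ℕ) :
    constantCoeff (1 - X ^ (n + 1) : PowerSeries ℚ) ≠ 0 := by
  simp

/-- `1/(q)_n = (1 - q^{n+1})/(q)_{n+1}`. -/
lemma inv_pochN_one (n : ℕ) : (pochN 1 n)⁻¹ = (1 - X ^ (n + 1)) * (pochN 1 (n + 1))⁻¹ := by
  rw [pochN_one_succ, PowerSeries.mul_inv_rev, ← mul_assoc,
    PowerSeries.mul_inv_cancel _ (constantCoeff_one_sub_X_pow_succ n), one_mul]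

lemma inv_pochN_two (n : ℕ) : (pochN 2 n)⁻¹ = (1 - X) * (pochN 1 (n + 1))⁻¹ := by
  have h : constantCoeff (1 - X : PowerSeries ℚ) ≠ 0 := by simp
  rw [pochN_one_succ', PowerSeries.mul_inv_rev, mul_comm _ (1 - X : PowerSeries ℚ)⁻¹, ← mul_assoc,
    PowerSeries.mul_inv_cancel _ h, one_mul]

lemma gbinomQ_add (n d : ℕ) :
    gbinomQ (n + d) n = pochN 1 (n + d) * (pochN 1 n)⁻¹ * (pochN 1 d)⁻¹ := by
  rw [gbinomQ, if_pos (Nat.le_add_right n d), Nat.add_sub_cancel_left, PowerSeries.mul_inv_rev]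
  ring

lemma gbinomQ_of_lt {n k : ℕ} (h : n < k) : gbinomQ n k = 0 := if_neg h.not_ge

lemma inv_pochN_one_zero : (pochN 1 0)⁻¹ = 1 := by simp [pochN]

lemma gbinomQ_self (n : ℕ) : gbinomQ n n = 1 := by
  simpa [inv_pochN_one_zero, pochN_one_mul_inv] using gbinomQ_add n 0

lemma gbinomQ_zero_right (n : ℕ) : gbinomQ n 0 = 1 := by
  simpa [inv_pochN_one_zero, pochN_one_mul_inv] using gbinomQ_add 0 n

/-- The `q`-Pascal rule. -/
lemma gbinomQ_succ_succ (N n : ℕ) :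
    gbinomQ (N + 1) (n + 1) = X ^ (n + 1) * gbinomQ N (n + 1) + gbinomQ N n := by
  rcases lt_trichotomy N n with h | rfl | h
  · simp [gbinomQ_of_lt h, gbinomQ_of_lt (Nat.succ_lt_succ h), gbinomQ_of_lt (Nat.lt_succ_of_lt h)]
  · simp [gbinomQ_self, gbinomQ_of_lt (Nat.lt_succ_self N)]
  · obtain ⟨d, rfl⟩ := Nat.exists_eq_add_of_lt h
    have h₁ := gbinomQ_add (n + 1) (d + 1)
    have h₂ := gbinomQ_add (n + 1) d
    rw [show n + 1 + (d + 1) = n + d + 1 + 1 by ring] at h₁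
    rw [show n + 1 + d = n + d + 1 by ring] at h₂
    have h₃ := gbinomQ_add n (d + 1)
    rw [← add_assoc] at h₃
    rw [h₁, h₂, h₃, pochN_one_succ (n + d + 1), inv_pochN_one n, inv_pochN_one d]
    ring

/-- Absorption: `[N+1 choose n+1] (1 - q^{n+1}) = (1 - q^{N+1}) [N choose n]`. -/
lemma gbinomQ_succ_succ_mul (N n : ℕ) :
    gbinomQ (N + 1) (n + 1) * (1 - X ^ (n + 1)) = (1 - X ^ (N + 1)) * gbinomQ N n := by
  rcases lt_or_ge N n with h | h
  · simp [gbinomQ_of_lt h, gbinomQ_of_lt (Nat.succ_lt_succ h)]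
  · obtain ⟨d, rfl⟩ := Nat.exists_eq_add_of_le h
    have h₁ := gbinomQ_add (n + 1) d
    rw [show n + 1 + d = n + d + 1 by ring] at h₁
    rw [h₁, gbinomQ_add, pochN_one_succ (n + d), inv_pochN_one n]
    ring

/-- The limiting `q`-Vandermonde identity `∑ₙ q^{n²+an} [N choose n] / (q)_{n+a} = 1/(q)_{N+a}`. -/
lemma sum_gbinomQ_mul_inv (N a M : ℕ) (hM : N ≤ M) :
    ∑ n ∈ Finset.range (M + 1), X ^ (n ^ 2 + a * n) * gbinomQ N n * (pochN 1 (n + a))⁻¹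
      = (pochN 1 (N + a))⁻¹ := by
  induction N generalizing a M with
  | zero =>
    rw [Finset.sum_range_succ', Finset.sum_eq_zero fun n _ ↦ by
      rw [gbinomQ_of_lt n.succ_pos, mul_zero, zero_mul]]
    simp [gbinomQ_self]
  | succ N ih =>
    obtain ⟨M, rfl⟩ : ∃ m, M = m + 1 := ⟨M - 1, by omega⟩
    have hN : N ≤ M := by omega
    have first : ∑ n ∈ Finset.range (M + 1 + 1),
          X ^ (n ^ 2 + a * n + n) * gbinomQ N n * (pochN 1 (n + a))⁻¹
        = ∑ n ∈ Finset.range (M + 1),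
          X ^ (n ^ 2 + a * n + n) * gbinomQ N n * (pochN 1 (n + a))⁻¹ := by
      rw [Finset.sum_range_succ, gbinomQ_of_lt (show N < M + 1 by omega)]
      simp
    have pascal : ∑ n ∈ Finset.range (M + 1 + 1),
          X ^ (n ^ 2 + a * n) * gbinomQ (N + 1) n * (pochN 1 (n + a))⁻¹
        = (∑ n ∈ Finset.range (M + 1 + 1),
          X ^ (n ^ 2 + a * n + n) * gbinomQ N n * (pochN 1 (n + a))⁻¹)
        + ∑ n ∈ Finset.range (M + 1),
          X ^ ((n + 1) ^ 2 + a * (n + 1)) * gbinomQ N n * (pochN 1 (n + 1 + a))⁻¹ := by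
      rw [Finset.sum_range_succ', Finset.sum_range_succ' _ (M + 1), add_right_comm,
        ← Finset.sum_add_distrib]
      congr 1
      · refine Finset.sum_congr rfl fun n _ ↦ ?_
        rw [gbinomQ_succ_succ]
        ring
      · simp [gbinomQ_zero_right]
    rw [pascal, first, ← Finset.sum_add_distrib, show N + 1 + a = N + (a + 1) by ring,
      ← ih (a + 1) M hN]
    refine Finset.sum_congr rfl fun n _ ↦ ?_
    rw [inv_pochN_one (n + a), show n + 1 + a = n + a + 1 by ring, ← add_assoc n a 1]
    ring

lemma sum_gbinomQ_mul_one_sub (N M : ℕ) (hM : N ≤ M) :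
    ∑ n ∈ Finset.range (M + 1), X ^ (n ^ 2) * gbinomQ N n * ((1 - X ^ n) * (pochN 1 (n + 1))⁻¹)
      = X * ((1 - X ^ N) * (pochN 1 (N + 1))⁻¹) := by
  rw [Finset.sum_range_succ']
  cases N with
  | zero =>
    rw [Finset.sum_eq_zero fun n _ ↦ by
      rw [gbinomQ_of_lt n.succ_pos, mul_zero, zero_mul]]
    simp
  | succ N =>
    obtain ⟨M, rfl⟩ : ∃ m, M = m + 1 := ⟨M - 1, by omega⟩
    rw [show N + 1 + 1 = N + 2 by ring, ← sum_gbinomQ_mul_inv N 2 M (by omega), Finset.mul_sum,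
      Finset.mul_sum, pow_zero, sub_self, zero_mul, mul_zero, add_zero]
    refine Finset.sum_congr rfl fun n _ ↦ ?_
    calc _ = X ^ ((n + 1) ^ 2) * (gbinomQ (N + 1) (n + 1) * (1 - X ^ (n + 1)))
          * (pochN 1 (n + 2))⁻¹ := by ring
      _ = _ := by rw [gbinomQ_succ_succ_mul]; ring

/-- The right-hand side `(1 − q^t − q^{N+1}(1 − q^{t−1})) / (q)_{N+1}`. -/
def chainValue (t N : ℕ) : PowerSeries ℚ :=
  (1 - X ^ t - X ^ (N + 1) * (1 - X ^ (t - 1))) * (pochN 1 (N + 1))⁻¹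

lemma chainValue_one (N : ℕ) : chainValue 1 N = (1 - X) * (pochN 1 (N + 1))⁻¹ := by
  simp [chainValue]

lemma chainValue_succ (s N : ℕ) : chainValue (s + 1) N
    = (pochN 1 N)⁻¹ - X ^ (s + 1) * ((1 - X ^ N) * (pochN 1 (N + 1))⁻¹) := by
  rw [chainValue, inv_pochN_one N, Nat.add_sub_cancel]
  ring

lemma sum_mul_chainValue_one (N M : ℕ) (hM : N ≤ M) :
    ∑ n ∈ Finset.range (M + 1), X ^ (n ^ 2 + n) * gbinomQ N n * chainValue 1 n
      = chainValue 1 N := by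
  have h := sum_gbinomQ_mul_inv N 1 M hM
  simp only [chainValue_one, ← h, Finset.mul_sum]
  exact Finset.sum_congr rfl fun n _ ↦ by ring

lemma sum_mul_chainValue_succ (s N M : ℕ) (hM : N ≤ M) :
    ∑ n ∈ Finset.range (M + 1), X ^ (n ^ 2) * gbinomQ N n * chainValue (s + 1) n
      = chainValue (s + 2) N := by
  have h₁ := sum_gbinomQ_mul_inv N 0 M hM
  simp only [zero_mul, add_zero] at h₁
  rw [chainValue_succ (s + 1), ← h₁, pow_succ, mul_assoc, ← sum_gbinomQ_mul_one_sub N M hM,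
    Finset.mul_sum, ← Finset.sum_sub_distrib]
  refine Finset.sum_congr rfl fun n _ ↦ ?_
  rw [chainValue_succ]
  ring

/-- The summand attached to a tuple `g = (n₀, …, n_k)`. -/
def chainTerm (k t : ℕ) (g : Fin (k + 1) → ℕ) : PowerSeries ℚ :=
  if ∀ i : Fin k, g i.succ ≤ g i.castSucc then
    (X : PowerSeries ℚ) ^
        ((∑ i : Fin k, (g i.succ) ^ 2) + ∑ i : Fin k, if t ≤ i.1 + 1 then g i.succ else 0) *
      (∏ i : Fin k, gbinomQ (g i.castSucc) (g i.succ)) *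
      (pochN 2 (g (Fin.last k)))⁻¹
  else 0

lemma chainTerm_cons (k t t' N : ℕ) (h : Fin (k + 1) → ℕ)
    (ht : ∀ i, t ≤ i + 2 ↔ t' ≤ i + 1) :
    chainTerm (k + 1) t (Fin.cons N h)
      = X ^ (h 0 ^ 2 + if t ≤ 1 then h 0 else 0) * gbinomQ N (h 0) * chainTerm k t' h := by
  by_cases hN : h 0 ≤ N
  · have hlast : (Fin.cons N h : Fin (k + 2) → ℕ) (Fin.last (k + 1)) = h (Fin.last k) := by
      rw [← Fin.succ_last, Fin.cons_succ]
    simp only [chainTerm, Fin.forall_fin_succ (n := k), Fin.sum_univ_succ (n := k),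
      Fin.prod_univ_succ (n := k), Fin.cons_succ, Fin.castSucc_zero, Fin.cons_zero, hN, true_and,
      ← Fin.succ_castSucc, hlast, Fin.val_zero, Fin.val_succ, zero_add, add_assoc, Nat.reduceAdd,
      ht, mul_ite, mul_zero]
    congr 1
    ring
  · rw [gbinomQ_of_lt (not_le.mp hN), mul_zero, zero_mul, chainTerm, if_neg]
    intro H
    exact hN (by simpa using H 0)

lemma sum_chainTerm (k t N M : ℕ) (hM : N ≤ M) (ht : 1 ≤ t) (ht' : t ≤ k + 1) :
    ∑ f : Fin k → Fin (M + 1), chainTerm k t (Fin.cons N fun j ↦ (f j : ℕ))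
      = chainValue t N := by
  induction k generalizing t N with
  | zero =>
    obtain rfl : t = 1 := by omega
    simp [chainTerm, chainValue_one, inv_pochN_two]
  | succ k ih =>
    have split (t' : ℕ) (h : ∀ i, t ≤ i + 2 ↔ t' ≤ i + 1) (h₁ : 1 ≤ t') (h₂ : t' ≤ k + 1) :
        ∑ f : Fin (k + 1) → Fin (M + 1), chainTerm (k + 1) t (Fin.cons N fun j ↦ (f j : ℕ))
          = ∑ n ∈ Finset.range (M + 1),
            X ^ (n ^ 2 + if t ≤ 1 then n else 0) * gbinomQ N n * chainValue t' n := by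
      rw [Finset.sum_range, ← (Fin.consEquiv fun _ ↦ Fin (M + 1)).sum_comp, Fintype.sum_prod_type]
      refine Finset.sum_congr rfl fun n _ ↦ ?_
      rw [← ih t' n (Nat.le_of_lt_succ n.2) h₁ h₂, Finset.mul_sum]
      refine Finset.sum_congr rfl fun f _ ↦ ?_
      rw [chainTerm_cons k t t' N _ h]
      congr 2
      funext j
      refine Fin.cases ?_ (fun j ↦ ?_) j <;> simp [Fin.consEquiv]
    obtain rfl | ⟨s, rfl⟩ : t = 1 ∨ ∃ s, t = s + 2 := by
      rcases Nat.lt_or_ge t 2 with h | h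
      · exact Or.inl (by omega)
      · exact Or.inr ⟨t - 2, by omega⟩
    · rw [split 1 (fun i ↦ by omega) le_rfl (by omega)]
      simpa using sum_mul_chainValue_one N M hM
    · rw [split (s + 1) (fun i ↦ by omega) (by omega) (by omega)]
      simpa using sum_mul_chainValue_succ s N M hM

/-- Theorem `eqn:afinAG`: for `k ≥ 1`, `1 ≤ t ≤ k+1` and `n₀ ∈ ℕ`,
`∑_{n₀ ≥ n₁ ≥ ⋯ ≥ n_k ≥ 0} q^{n₁²+⋯+n_k² + n_t + ⋯ + n_k}
   [n₀ choose n₁]_q ⋯ [n_{k−1} choose n_k]_q / (q²;q)_{n_k}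
 = (1 − q^t − q^{n₀+1}(1 − q^{t−1})) / (q;q)_{n₀+1}`.
The sum is encoded as a sum over all tuples `(n₁,…,n_k)` with entries `≤ n₀`
(no restriction given the chain condition; tuples violating it contribute `0`). -/
theorem statement4 (k t n₀ : ℕ) (hk : 1 ≤ k) (ht : 1 ≤ t) (ht' : t ≤ k + 1) :
    (∑ f : Fin k → Fin (n₀ + 1),
      (fun g : Fin (k + 1) → ℕ =>
        if ∀ i : Fin k, g i.succ ≤ g i.castSucc then
          (X : PowerSeries ℚ) ^
              ((∑ i : Fin k, (g i.succ) ^ 2) +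
                ∑ i : Fin k, if t ≤ i.1 + 1 then g i.succ else 0) *
            (∏ i : Fin k, gbinomQ (g i.castSucc) (g i.succ)) *
            (pochN 2 (g (Fin.last k)))⁻¹
        else 0)
      (Fin.cons n₀ (fun j => (f j : ℕ))))
      = (1 - (X : PowerSeries ℚ) ^ t -
          (X : PowerSeries ℚ) ^ (n₀ + 1) * (1 - (X : PowerSeries ℚ) ^ (t - 1))) *
          (pochN 1 (n₀ + 1))⁻¹ := by
  exact sum_chainTerm k t n₀ n₀ le_rfl ht ht'
end
end

section
/- Let k ≥ 3 and let c₀ ≥ c₁ ≥ c₂ ≥ 0 be integers with c₀ + c₁ + c₂ = 3k − 3 and c₁ ≥ k. Then the following identity of formal power series in q holds: θ(q^{c₀+1};q^{3k}) θ(q^{c₁+1};q^{3k}) θ(q^{c₂+1};q^{3k}) = θ(q^{2k−c₂−1};q^{3k}) θ(q^{2k−c₁−1};q^{3k}) θ(q^{2k−c₀−1};q^{3k}) − q^{c₂+1} · θ(q^{2k+c₂+1};q^{3k}) θ(q^{c₀−k+1};q^{3k}) θ(q^{c₁−k+1};q^{3k}). (Under the stated hypotheses every exponent appearing above lies strictly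 between 0 and 3k, so every theta factor is a well-defined formal power series.) -/
noncomputable section

open PowerSeries

/-- The coefficientwise (product) topology on `ℚ[[q]]`. -/
instance : TopologicalSpace (PowerSeries ℚ) :=
  inferInstanceAs (TopologicalSpace ((Unit →₀ ℕ) → ℚ))

/-- For `0 < j < N`, the theta function
`θ(q^j;q^N) = (q^j;q^N)_∞ (q^{N−j};q^N)_∞ = ∏_{t≥0}(1−q^{j+Nt}) · ∏_{t≥0}(1−q^{(N−j)+Nt})`
as a formal power series in `q`. -/
def theta (j N : ℕ) : PowerSeries ℚ :=
  (∏' t : ℕ, (1 - (X : PowerSeries ℚ) ^ (j + N * t))) *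
    (∏' t : ℕ, (1 - (X : PowerSeries ℚ) ^ ((N - j) + N * t)))

section Finite

variable {R : Type*} [CommRing R]

/-- The `q`-factorial-type product `(q;q)_n = ∏_{i=1}^n (1 - q^i)`. -/
def qPoch (q : R) (n : ℕ) : R := ∏ i ∈ Finset.range n, (1 - q ^ (i + 1))

/-- The Gaussian binomial coefficient `[n choose k]_q`. -/
def gaussBinom (q : R) : ℕ → ℕ → R
  | _, 0 => 1
  | 0, _ + 1 => 0
  | n + 1, k + 1 => gaussBinom q n k + q ^ (k + 1) * gaussBinom q n (k + 1)

theorem gaussBinom_zero_right (q : R) (n : ℕ) : gaussBinom q n 0 = 1 := by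
  cases n <;> rfl

theorem gaussBinom_eq_zero (q : R) {n k : ℕ} (h : n < k) : gaussBinom q n k = 0 := by
  induction n generalizing k with
  | zero => obtain ⟨k, rfl⟩ := Nat.exists_eq_succ_of_ne_zero (by omega : k ≠ 0); rfl
  | succ n ih =>
    obtain ⟨k, rfl⟩ := Nat.exists_eq_succ_of_ne_zero (by omega : k ≠ 0)
    rw [gaussBinom, ih (by omega), ih (by omega)]; simp

theorem gaussBinom_self (q : R) (n : ℕ) : gaussBinom q n n = 1 := by
  induction n with
  | zero => rfl
  | succ n ih => rw [gaussBinom, ih, gaussBinom_eq_zero q (Nat.lt_succ_self n)]; simp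

theorem qPoch_succ (q : R) (n : ℕ) : qPoch q (n + 1) = qPoch q n * (1 - q ^ (n + 1)) :=
  Finset.prod_range_succ _ _

theorem qPoch_mul_gaussBinom (q : R) (k l : ℕ) :
    qPoch q k * qPoch q l * gaussBinom q (k + l) k = qPoch q (k + l) := by
  induction h : k + l generalizing k l with
  | zero =>
    obtain ⟨rfl, rfl⟩ : k = 0 ∧ l = 0 := by omega
    simp [qPoch, gaussBinom]
  | succ n ih =>
    rcases k with _ | k
    · obtain rfl : l = n + 1 := by omega
      simp [qPoch, gaussBinom_zero_right]
    rcases l with _ | l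
    · obtain rfl : k = n := by omega
      simp [gaussBinom_self, qPoch]
    have h1 := ih k (l + 1) (by omega)
    have h2 := ih (k + 1) l (by omega)
    rw [gaussBinom, qPoch_succ q n, show n + 1 = (k + 1) + (l + 1) by omega, pow_add]
    rw [qPoch_succ q k, qPoch_succ q l] at *
    linear_combination (1 - q ^ (k + 1)) * h1 + q ^ (k + 1) * (1 - q ^ (l + 1)) * h2

theorem prod_add_mul_pow (q y z : R) (M : ℕ) :
    ∏ i ∈ Finset.range M, (y + z * q ^ i) = ∑ k ∈ Finset.range (M + 1),
      q ^ (k.choose 2) * gaussBinom q M k * z ^ k * y ^ (M - k) := by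
  induction M generalizing z with
  | zero => simp [gaussBinom]
  | succ M ih =>
    have h1 : ∏ i ∈ Finset.range (M + 1), (y + z * q ^ i) =
        (y + z) * ∏ i ∈ Finset.range M, (y + (z * q) * q ^ i) := by
      rw [Finset.prod_range_succ', mul_comm]
      simp [pow_succ', mul_assoc]
    rw [h1, ih, Finset.sum_range_succ' _ (M + 1), add_mul, Finset.mul_sum, Finset.mul_sum]
    have h2 : ∑ k ∈ Finset.range (M + 1),
        y * (q ^ k.choose 2 * gaussBinom q M k * (z * q) ^ k * y ^ (M - k)) =
        ∑ k ∈ Finset.range (M + 1), q ^ (k + 1).choose 2 * (q ^ (k + 1) * gaussBinom q M (k + 1)) *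
          z ^ (k + 1) * y ^ (M + 1 - (k + 1)) + y ^ (M + 1) := by
      rw [Finset.sum_range_succ', Finset.sum_range_succ (n := M),
        gaussBinom_eq_zero q (Nat.lt_succ_self M)]
      simp only [gaussBinom_zero_right]
      congr 1
      · simp only [mul_zero, zero_mul, add_zero]
        refine Finset.sum_congr rfl fun k hk => ?_
        have : M - k = M - (k + 1) + 1 := by have := Finset.mem_range.1 hk; omega
        rw [Nat.add_sub_add_right, this]
        ring
      · simp [pow_succ']
    rw [h2, add_right_comm, ← Finset.sum_add_distrib]
    congr 1
    · refine Finset.sum_congr rfl fun k _ => ?_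
      rw [gaussBinom, Nat.choose_succ_succ' k 1, Nat.choose_one_right, Nat.add_sub_add_right]
      ring
    · simp [gaussBinom_zero_right]

end Finite

section Topology

instance : IsTopologicalRing (PowerSeries ℚ) :=
  PowerSeries.WithPiTopology.instIsTopologicalRing ℚ

instance : T3Space (PowerSeries ℚ) :=
  inferInstanceAs (T3Space ((Unit →₀ ℕ) → ℚ))

theorem hasSum_iff_coeff {ι : Type*} {f : ι → PowerSeries ℚ} {g : PowerSeries ℚ} :
    HasSum f g ↔ ∀ d, HasSum (fun i => coeff d (f i)) (coeff d g) :=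
  PowerSeries.WithPiTopology.hasSum_iff_hasSum_coeff ℚ

theorem summable_mul_X_pow {ι : Type*} (c : ι → PowerSeries ℚ) (e : ι → ℕ)
    (he : ∀ n, {i | e i ≤ n}.Finite) :
    Summable fun i => c i * (X : PowerSeries ℚ) ^ e i := by
  refine (PowerSeries.WithPiTopology.summable_iff_summable_coeff ℚ).2 fun d => ?_
  refine summable_of_hasFiniteSupport ((he d).subset fun i hi => ?_)
  by_contra h
  refine hi ?_
  have h' : ¬ e i ≤ d := h
  simp [coeff_mul_X_pow', h']

theorem X_pow_dvd_hasSum_sub {ι : Type*} {f : ι → PowerSeries ℚ} {S : PowerSeries ℚ}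
    (hf : HasSum f S) (s : Finset ι) (n : ℕ) (h : ∀ i ∉ s, X ^ n ∣ f i) :
    X ^ n ∣ S - ∑ i ∈ s, f i := by
  rw [X_pow_dvd_iff]
  intro d hd
  rw [map_sub, map_sum, sub_eq_zero]
  refine (hasSum_iff_coeff.1 hf d).unique (hasSum_sum_of_ne_finset_zero fun i hi => ?_)
  exact X_pow_dvd_iff.1 (h i hi) d hd

theorem X_pow_dvd_prod_sub_one {ι : Type*} (f : ι → PowerSeries ℚ) (s : Finset ι) (n : ℕ)
    (h : ∀ i ∈ s, X ^ n ∣ f i - 1) : X ^ n ∣ ∏ i ∈ s, f i - 1 := by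
  classical
  induction s using Finset.induction_on with
  | empty => simp
  | insert a s ha ih =>
    rw [Finset.prod_insert ha]
    have h1 := h a (Finset.mem_insert_self a s)
    have h2 := ih fun i hi => h i (Finset.mem_insert_of_mem hi)
    convert dvd_add (h1.mul_right (∏ i ∈ s, f i)) h2 using 1
    ring

theorem X_pow_dvd_hasProd_sub {ι : Type*} {f : ι → PowerSeries ℚ} {P : PowerSeries ℚ}
    (hf : HasProd f P) (s : Finset ι) (n : ℕ) (h : ∀ i ∉ s, X ^ n ∣ f i - 1) :
    X ^ n ∣ P - ∏ i ∈ s, f i := by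
  classical
  rw [X_pow_dvd_iff]
  intro d hd
  have h1 := (PowerSeries.WithPiTopology.tendsto_iff_coeff_tendsto ℚ _ _ _).1 hf d
  rw [map_sub, sub_eq_zero]
  refine tendsto_nhds_unique h1 (tendsto_nhds_of_eventually_eq ?_)
  simp only [SummationFilter.unconditional_filter]
  filter_upwards [Filter.eventually_ge_atTop s] with t ht
  rw [← sub_eq_zero, ← map_sub]
  refine X_pow_dvd_iff.1 ?_ d hd
  rw [← Finset.prod_sdiff ht]
  have := (X_pow_dvd_prod_sub_one f (t \ s) n
    fun i hi => h i (Finset.mem_sdiff.1 hi).2).mul_right (∏ i ∈ s, f i)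
  rwa [sub_mul, one_mul] at this

theorem multipliable_one_sub_X_pow_linear (j : ℕ) {N : ℕ} (hN : 0 < N) :
    Multipliable fun t : ℕ => 1 - (X : PowerSeries ℚ) ^ (j + N * t) := by
  simp_rw [sub_eq_add_neg]
  refine PowerSeries.WithPiTopology.multipliable_one_add_of_tendsto_order_atTop_nhds_top ℚ ?_
  refine ENat.tendsto_nhds_top_iff_natCast_lt.mpr fun n =>
    Filter.eventually_atTop.mpr ⟨n + 1, fun m hm => ?_⟩
  rw [order_neg, order_X_pow]
  norm_cast
  nlinarith

theorem X_pow_dvd_tprod_sub {j N : ℕ} (hN : 0 < N) (m n : ℕ) (h : n ≤ j + N * m) :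
    X ^ n ∣ ∏' t : ℕ, (1 - (X : PowerSeries ℚ) ^ (j + N * t)) -
      ∏ t ∈ Finset.range m, (1 - (X : PowerSeries ℚ) ^ (j + N * t)) := by
  refine X_pow_dvd_hasProd_sub (multipliable_one_sub_X_pow_linear j hN).hasProd _ n fun i hi => ?_
  rw [sub_sub_cancel_left, dvd_neg]
  refine pow_dvd_pow _ (h.trans ?_)
  have : m ≤ i := by simpa using hi
  gcongr

theorem tprod_one_sub_ne_zero {j N : ℕ} (hj : 0 < j) (hN : 0 < N) :
    ∏' t : ℕ, (1 - (X : PowerSeries ℚ) ^ (j + N * t)) ≠ 0 := by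
  intro h
  have := X_pow_dvd_tprod_sub hN 0 1 (by omega : 1 ≤ j + N * 0)
  rw [h] at this
  simp [X_dvd_iff] at this

end Topology

section JacobiTriple

/-- The exponent `N * m * (m - 1) / 2 + j * m` in the Jacobi triple product. -/
def thetaExp (N j : ℕ) (m : ℤ) : ℕ := (N * (m * (m - 1) / 2) + j * m).toNat

theorem two_mul_ediv_two_mul_pred (m : ℤ) : 2 * (m * (m - 1) / 2) = m * (m - 1) := by
  have : 2 ∣ m * (m - 1) := by
    simpa [mul_comm] using (Int.even_mul_pred_self m).two_dvd
  omega

theorem abs_le_thetaExp_aux {N j : ℕ} (hj : 0 < j) (hjN : j < N) (m : ℤ) :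
    |m| ≤ N * (m * (m - 1) / 2) + j * m := by
  have h := two_mul_ediv_two_mul_pred m
  set c := m * (m - 1) / 2
  have h1 : (1 : ℤ) ≤ j := by exact_mod_cast hj
  have h2 : (j : ℤ) + 1 ≤ N := by exact_mod_cast hjN
  rcases le_or_gt 0 m with hm | hm
  · rw [abs_of_nonneg hm]
    have : 0 ≤ c := by
      rcases hm.eq_or_lt with rfl | hm
      · omega
      · nlinarith
    nlinarith
  · rw [abs_of_neg hm]
    have : -m ≤ c := by nlinarith
    nlinarith

theorem cast_thetaExp {N j : ℕ} (hj : 0 < j) (hjN : j < N) (m : ℤ) :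
    (thetaExp N j m : ℤ) = N * (m * (m - 1) / 2) + j * m :=
  Int.toNat_of_nonneg ((abs_nonneg m).trans (abs_le_thetaExp_aux hj hjN m))

theorem two_mul_thetaExp {N j : ℕ} (hj : 0 < j) (hjN : j < N) (m : ℤ) :
    2 * (thetaExp N j m : ℤ) = N * (m * (m - 1)) + 2 * j * m := by
  rw [cast_thetaExp hj hjN]
  linear_combination (N : ℤ) * two_mul_ediv_two_mul_pred m

theorem natAbs_le_thetaExp {N j : ℕ} (hj : 0 < j) (hjN : j < N) (m : ℤ) :
    m.natAbs ≤ thetaExp N j m := by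
  have h := abs_le_thetaExp_aux hj hjN m
  rw [← cast_thetaExp hj hjN, Int.abs_eq_natAbs] at h
  exact_mod_cast h

theorem two_mul_choose_two (n : ℕ) : 2 * (n.choose 2 : ℤ) = n * (n - 1) := by
  induction n with
  | zero => simp
  | succ n ih =>
    rw [Nat.choose_succ_succ' n 1, Nat.choose_one_right]
    push_cast
    linarith [ih]

theorem finite_thetaExp_le {N j : ℕ} (hj : 0 < j) (hjN : j < N) (n : ℕ) :
    {m : ℤ | thetaExp N j m ≤ n}.Finite := by
  refine (Set.finite_Icc (-n : ℤ) n).subset fun m hm => ?_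
  have h1 : thetaExp N j m ≤ n := hm
  have h2 := natAbs_le_thetaExp hj hjN m
  rw [Set.mem_Icc]
  omega

/-- The sign `(-1)^m` as a power series. -/
def signSeries (m : ℤ) : PowerSeries ℚ := ((m.negOnePow : ℤ) : PowerSeries ℚ)

theorem signSeries_add (m n : ℤ) : signSeries (m + n) = signSeries m * signSeries n := by
  simp [signSeries, Int.negOnePow_add]

theorem signSeries_neg (m : ℤ) : signSeries (-m) = signSeries m := by
  simp [signSeries]

theorem signSeries_natCast (n : ℕ) : signSeries n = (-1) ^ n := by
  simp [signSeries, Int.negOnePow_def]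

theorem signSeries_mul_self (n : ℤ) : signSeries n * signSeries n = 1 := by
  rw [signSeries, ← Int.cast_mul, ← Units.val_mul, Int.units_mul_self]; simp

theorem finite_jacobi_triple {N j : ℕ} (hj : 0 < j) (hjN : j < N) (n : ℕ) :
    (∏ i ∈ Finset.range n, (1 - (X : PowerSeries ℚ) ^ (j + N * i))) *
      (∏ i ∈ Finset.range n, (1 - (X : PowerSeries ℚ) ^ ((N - j) + N * i))) =
    ∑ k ∈ Finset.range (2 * n + 1), signSeries (k - n) * X ^ thetaExp N j (k - n) *
      gaussBinom ((X : PowerSeries ℚ) ^ N) (2 * n) k := by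
  rcases Nat.eq_zero_or_pos n with rfl | hn
  · simp [gaussBinom, signSeries, thetaExp]
  have hle : j ≤ N * n := hjN.le.trans (Nat.le_mul_of_pos_right N hn)
  have key := prod_add_mul_pow ((X : PowerSeries ℚ) ^ N) (-X ^ (N * n - j)) 1 (2 * n)
  set D := N * n.choose 2 + n * (N * n - j) with hD
  have hX : ((-1) ^ n * X ^ D : PowerSeries ℚ) ≠ 0 :=
    mul_ne_zero (pow_ne_zero _ (by simp)) (pow_ne_zero _ X_ne_zero)
  refine mul_left_cancel₀ hX ?_
  have hL : ∏ i ∈ Finset.range (2 * n), (-(X : PowerSeries ℚ) ^ (N * n - j) + 1 * (X ^ N) ^ i) =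
      ((-1) ^ n * X ^ D) * ((∏ i ∈ Finset.range n, (1 - (X : PowerSeries ℚ) ^ (j + N * i))) *
      (∏ i ∈ Finset.range n, (1 - (X : PowerSeries ℚ) ^ ((N - j) + N * i)))) := by
    rw [two_mul, Finset.prod_range_add]
    have e1 : ∏ i ∈ Finset.range n, (-(X : PowerSeries ℚ) ^ (N * n - j) + 1 * (X ^ N) ^ i) =
        X ^ (N * n.choose 2) *
          ∏ i ∈ Finset.range n, (1 - (X : PowerSeries ℚ) ^ ((N - j) + N * i)) := by
      rw [← Finset.prod_range_reflect (fun i => 1 - (X : PowerSeries ℚ) ^ ((N - j) + N * i)),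
        pow_mul, Nat.choose_two_right, ← Finset.sum_range_id, ← Finset.prod_pow_eq_pow_sum,
        ← Finset.prod_mul_distrib]
      refine Finset.prod_congr rfl fun i hi => ?_
      have hi := Finset.mem_range.1 hi
      obtain ⟨d, rfl⟩ : ∃ d, n = i + 1 + d := ⟨n - (i + 1), by omega⟩
      have : N * (i + 1 + d) - j = N * i + (N - j + N * (i + 1 + d - 1 - i)) := by
        rw [show i + 1 + d - 1 - i = d by omega]
        zify [hle, hjN.le]; ring
      rw [this, pow_add, ← pow_mul]; ring
    have e2 : ∏ i ∈ Finset.range n, (-(X : PowerSeries ℚ) ^ (N * n - j) + 1 * (X ^ N) ^ (n + i)) =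
        (-1) ^ n * X ^ (n * (N * n - j)) *
          ∏ i ∈ Finset.range n, (1 - (X : PowerSeries ℚ) ^ (j + N * i)) := by
      have : ((-1) ^ n * X ^ (n * (N * n - j)) : PowerSeries ℚ) =
          ∏ i ∈ Finset.range n, (-X ^ (N * n - j)) := by
        rw [Finset.prod_const, Finset.card_range, neg_pow (X ^ _), ← pow_mul, mul_comm n]
      rw [this, ← Finset.prod_mul_distrib]
      refine Finset.prod_congr rfl fun i _ => ?_
      have : N * (n + i) = (N * n - j) + (j + N * i) := by
        zify [hle]; ring
      rw [← pow_mul, this, pow_add]; ring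
    rw [e1, e2, hD, pow_add]; ring
  rw [← hL, key, Finset.mul_sum]
  refine Finset.sum_congr rfl fun k hk => ?_
  have hk : k ≤ 2 * n := by have := Finset.mem_range.1 hk; omega
  have hexp : N * k.choose 2 + (N * n - j) * (2 * n - k) = D + thetaExp N j (k - n) := by
    have h1 := two_mul_choose_two k
    have h2 := two_mul_choose_two n
    have h3 := two_mul_thetaExp hj hjN (k - n)
    zify [hle, hk, hD]
    refine mul_left_cancel₀ (two_ne_zero (α := ℤ)) ?_
    linear_combination (N : ℤ) * h1 - N * h2 - h3
  have hsign : ((-1) ^ (2 * n - k) : PowerSeries ℚ) = (-1) ^ n * signSeries (k - n) := by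
    rw [← signSeries_natCast, ← signSeries_natCast, ← signSeries_neg (k - n), ← signSeries_add]
    congr 1
    omega
  rw [neg_pow (X ^ _), ← pow_mul, ← pow_mul, hsign, one_pow]
  have := congrArg (fun e => (X : PowerSeries ℚ) ^ e) hexp
  simp only [pow_add] at this
  linear_combination (-1) ^ n * signSeries (k - n) * gaussBinom ((X : PowerSeries ℚ) ^ N) (2 * n) k * this

/-- The infinite product `(q^N;q^N)_∞`. -/
def eulerProd (N : ℕ) : PowerSeries ℚ := ∏' t : ℕ, (1 - (X : PowerSeries ℚ) ^ (N + N * t))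

theorem qPoch_X_pow (N n : ℕ) : qPoch ((X : PowerSeries ℚ) ^ N) n =
    ∏ t ∈ Finset.range n, (1 - (X : PowerSeries ℚ) ^ (N + N * t)) := by
  refine Finset.prod_congr rfl fun i _ => ?_
  rw [← pow_mul]; ring

theorem X_pow_dvd_eulerProd_sub {N : ℕ} (hN : 0 < N) {n m : ℕ} (h : n ≤ m) :
    X ^ n ∣ eulerProd N - qPoch ((X : PowerSeries ℚ) ^ N) m := by
  rw [qPoch_X_pow]
  exact X_pow_dvd_tprod_sub hN m n (by nlinarith)

theorem eulerProd_ne_zero {N : ℕ} (hN : 0 < N) : eulerProd N ≠ 0 := tprod_one_sub_ne_zero hN hN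

theorem not_X_dvd_eulerProd {N : ℕ} (hN : 0 < N) : ¬ X ∣ eulerProd N := by
  intro h
  have := X_pow_dvd_tprod_sub hN 0 1 (by omega : 1 ≤ N + N * 0)
  rw [pow_one] at this
  have := (dvd_sub_right h).1 this
  simp [X_dvd_iff] at this

theorem X_pow_dvd_eulerProd_mul_gaussBinom_sub {N : ℕ} (hN : 0 < N) {n k l : ℕ}
    (hk : n ≤ k) (hl : n ≤ l) :
    X ^ n ∣ eulerProd N * gaussBinom ((X : PowerSeries ℚ) ^ N) (k + l) k - 1 := by
  have h := qPoch_mul_gaussBinom ((X : PowerSeries ℚ) ^ N) k l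
  have h1 := X_pow_dvd_eulerProd_sub hN hk
  have h2 := X_pow_dvd_eulerProd_sub hN hl
  have h3 := X_pow_dvd_eulerProd_sub hN (hk.trans (Nat.le_add_right k l))
  refine X_prime.pow_dvd_of_dvd_mul_left n (not_X_dvd_eulerProd hN) ?_
  have := ((h1.mul_right (eulerProd N * gaussBinom ((X : PowerSeries ℚ) ^ N) (k + l) k)).add
    (h2.mul_right (qPoch (X ^ N) k * gaussBinom ((X : PowerSeries ℚ) ^ N) (k + l) k))).sub h3
  convert this using 1
  linear_combination h

theorem hasSum_theta {N j : ℕ} (hj : 0 < j) (hjN : j < N) :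
    HasSum (fun m : ℤ => signSeries m * (X : PowerSeries ℚ) ^ thetaExp N j m)
      (eulerProd N * theta j N) := by
  have hN : 0 < N := hj.trans hjN
  obtain ⟨S, hS⟩ := summable_mul_X_pow signSeries _ (finite_thetaExp_le hj hjN)
  suffices h : ∀ n, X ^ n ∣ eulerProd N * theta j N - S by
    have : eulerProd N * theta j N - S = 0 := by
      ext d
      exact X_pow_dvd_iff.1 (h (d + 1)) d (Nat.lt_succ_self d)
    rwa [sub_eq_zero.1 this]
  intro n
  let φ : ℕ ↪ ℤ := ⟨fun k => (k : ℤ) - n, fun a b h => by simpa using h⟩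
  have h1 := X_pow_dvd_hasSum_sub hS ((Finset.range (2 * n + 1)).map φ) n fun m hm => by
    refine (pow_dvd_pow X ?_).mul_left _
    refine le_trans ?_ (natAbs_le_thetaExp hj hjN m)
    by_contra hlt
    refine hm (Finset.mem_map.2 ⟨(m + n).toNat, ?_, ?_⟩)
    · rw [Finset.mem_range]; omega
    · change ((m + n).toNat : ℤ) - n = m
      omega
  rw [Finset.sum_map] at h1
  have h2 := X_pow_dvd_tprod_sub (j := j) hN n n (by nlinarith)
  have h3 := X_pow_dvd_tprod_sub (j := N - j) hN n n (by nlinarith)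
  have h4 := finite_jacobi_triple hj hjN n
  have h5 : X ^ n ∣ ∑ k ∈ Finset.range (2 * n + 1),
      signSeries (k - n) * (X : PowerSeries ℚ) ^ thetaExp N j (k - n) *
        (eulerProd N * gaussBinom ((X : PowerSeries ℚ) ^ N) (2 * n) k - 1) := by
    refine Finset.dvd_sum fun k hk => ?_
    have hk : k < 2 * n + 1 := Finset.mem_range.1 hk
    have ha := natAbs_le_thetaExp hj hjN (k - n)
    have hb := X_pow_dvd_eulerProd_mul_gaussBinom_sub hN
      (min_le_left k (2 * n - k)) (min_le_right k (2 * n - k))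
    rw [Nat.add_sub_cancel' (by omega)] at hb
    refine (pow_dvd_pow X ?_ : X ^ n ∣ X ^ (thetaExp N j (k - n) + min k (2 * n - k))).trans ?_
    · omega
    · rw [pow_add]
      exact mul_dvd_mul (dvd_mul_left _ _) hb
  simp only [mul_sub, mul_one, Finset.sum_sub_distrib] at h5
  have h6 : ∑ k ∈ Finset.range (2 * n + 1),
      signSeries (k - n) * (X : PowerSeries ℚ) ^ thetaExp N j (k - n) *
        (eulerProd N * gaussBinom ((X : PowerSeries ℚ) ^ N) (2 * n) k) =
      eulerProd N * ((∏ i ∈ Finset.range n, (1 - (X : PowerSeries ℚ) ^ (j + N * i))) *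
      (∏ i ∈ Finset.range n, (1 - (X : PowerSeries ℚ) ^ ((N - j) + N * i)))) := by
    rw [h4, Finset.mul_sum]
    exact Finset.sum_congr rfl fun k _ => by ring
  rw [h6] at h5
  change X ^ n ∣ S - ∑ k ∈ Finset.range (2 * n + 1),
      signSeries (k - n) * (X : PowerSeries ℚ) ^ thetaExp N j (k - n) at h1
  rw [theta]
  set A := ∏' t : ℕ, (1 - (X : PowerSeries ℚ) ^ (j + N * t))
  set B := ∏' t : ℕ, (1 - (X : PowerSeries ℚ) ^ ((N - j) + N * t))
  have := ((h2.mul_right (eulerProd N * B)).add (h3.mul_right (eulerProd N *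
    ∏ i ∈ Finset.range n, (1 - (X : PowerSeries ℚ) ^ (j + N * i))))).add (h5.sub h1)
  convert this using 1
  ring

end JacobiTriple

section SquareSeries

/-- The series `∑ q^{d^2}` over the integers `d ≡ N * i + A` modulo `2 * N`. -/
def sqSeries (N : ℕ) (i A : ℤ) : PowerSeries ℚ :=
  ∑' t : ℤ, (X : PowerSeries ℚ) ^ ((N * (2 * t + i) + A).natAbs ^ 2)

theorem finite_sq_le {N : ℕ} (hN : 0 < N) (i A : ℤ) (n : ℕ) :
    {t : ℤ | (N * (2 * t + i) + A).natAbs ^ 2 ≤ n}.Finite := by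
  refine ((Set.finite_Icc (-n : ℤ) n).preimage (f := fun t : ℤ => N * (2 * t + i) + A)
    fun a _ b _ h => ?_).subset fun t ht => ?_
  · have h' : (N : ℤ) * (2 * a + i) = N * (2 * b + i) := add_right_cancel h
    have := mul_left_cancel₀ (by exact_mod_cast hN.ne') h'
    omega
  · have h1 : (N * (2 * t + i) + A).natAbs ^ 2 ≤ n := ht
    have h2 : (N * (2 * t + i) + A).natAbs ≤ n := (Nat.le_self_pow two_ne_zero _).trans h1
    rw [Set.mem_preimage, Set.mem_Icc]
    omega

theorem hasSum_sqSeries {N : ℕ} (hN : 0 < N) (i A : ℤ) :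
    HasSum (fun t : ℤ => (X : PowerSeries ℚ) ^ ((N * (2 * t + i) + A).natAbs ^ 2))
      (sqSeries N i A) := by
  have := summable_mul_X_pow (fun _ => 1) _ (finite_sq_le hN i A)
  simp only [one_mul] at this
  exact this.hasSum

/-- The antisymmetric pairing whose values are products of two theta functions. -/
def sqBracket (N : ℕ) (A B : ℤ) : PowerSeries ℚ :=
  sqSeries N 1 A * sqSeries N 0 B - sqSeries N 0 A * sqSeries N 1 B

theorem sqBracket_plucker (N : ℕ) (w x y z : ℤ) :
    sqBracket N w x * sqBracket N y z =
      sqBracket N y x * sqBracket N w z - sqBracket N w y * sqBracket N z x := by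
  simp only [sqBracket]; ring

theorem finite_prod_add_le {ι κ : Type*} {e : ι → ℕ} {e' : κ → ℕ}
    (h : ∀ n, {i | e i ≤ n}.Finite) (h' : ∀ n, {i | e' i ≤ n}.Finite) (n : ℕ) :
    {p : ι × κ | e p.1 + e' p.2 ≤ n}.Finite :=
  ((h n).prod (h' n)).subset fun _ hp =>
    ⟨(Nat.le_add_right _ _).trans hp, (Nat.le_add_left _ _).trans hp⟩

theorem hasSum_mul {ι κ : Type*} {f : ι → PowerSeries ℚ} {g : κ → PowerSeries ℚ}
    {S S' : PowerSeries ℚ} (hS : HasSum f S) (hS' : HasSum g S')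
    (hs : Summable fun p : ι × κ => f p.1 * g p.2) :
    HasSum (fun p : ι × κ => f p.1 * g p.2) (S * S') :=
  hS.mul hS' hs

theorem summable_mul_X_pow_mul {ι κ : Type*} {c : ι → PowerSeries ℚ} {c' : κ → PowerSeries ℚ}
    {e : ι → ℕ} {e' : κ → ℕ}
    (h : ∀ n, {i | e i ≤ n}.Finite) (h' : ∀ n, {i | e' i ≤ n}.Finite) :
    Summable (fun p : ι × κ => (c p.1 * X ^ e p.1) * (c' p.2 * X ^ e' p.2)) := by
  have hs := summable_mul_X_pow (fun p : ι × κ => c p.1 * c' p.2) _ (finite_prod_add_le h h')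
  refine hs.congr fun p => ?_
  rw [pow_add, mul_mul_mul_comm]

theorem hasSum_mul_X_pow_mul {ι κ : Type*} {c : ι → PowerSeries ℚ} {c' : κ → PowerSeries ℚ}
    {e : ι → ℕ} {e' : κ → ℕ} {S S' : PowerSeries ℚ}
    (h : ∀ n, {i | e i ≤ n}.Finite) (h' : ∀ n, {i | e' i ≤ n}.Finite)
    (hS : HasSum (fun i => c i * X ^ e i) S) (hS' : HasSum (fun i => c' i * X ^ e' i) S') :
    HasSum (fun p : ι × κ => c p.1 * c' p.2 * X ^ (e p.1 + e' p.2)) (S * S') := by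
  have he := hasSum_mul hS hS' (summable_mul_X_pow_mul h h')
  have : (fun p : ι × κ => c p.1 * c' p.2 * (X : PowerSeries ℚ) ^ (e p.1 + e' p.2)) =
      fun p => (c p.1 * X ^ e p.1) * (c' p.2 * X ^ e' p.2) :=
    funext fun p => by rw [pow_add, mul_mul_mul_comm]
  rw [this]
  exact he

theorem hasSum_sqSeries_mul {N : ℕ} (hN : 0 < N) (i j A B : ℤ) :
    HasSum (fun p : ℤ × ℤ => (X : PowerSeries ℚ) ^
      ((N * (2 * p.1 + i) + A).natAbs ^ 2 + (N * (2 * p.2 + j) + B).natAbs ^ 2))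
      (sqSeries N i A * sqSeries N j B) := by
  have := hasSum_mul_X_pow_mul (c := fun _ => 1) (c' := fun _ => 1)
    (finite_sq_le hN i A) (finite_sq_le hN j B)
    (by simpa only [one_mul] using hasSum_sqSeries hN i A)
    (by simpa only [one_mul] using hasSum_sqSeries hN j B)
  simpa only [one_mul] using this

theorem hasSum_expand {ι : Type*} {f : ι → PowerSeries ℚ} {S : PowerSeries ℚ} (hS : HasSum f S)
    (p : ℕ) (hp : p ≠ 0) : HasSum (fun i => expand p hp (f i)) (expand p hp S) := by
  rw [hasSum_iff_coeff] at hS ⊢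
  intro d
  simp only [coeff_expand]
  split_ifs
  · exact hS _
  · exact hasSum_zero

theorem expand_injective (p : ℕ) (hp : p ≠ 0) :
    Function.Injective (expand p hp : PowerSeries ℚ →ₐ[ℚ] PowerSeries ℚ) := by
  intro f g h
  ext d
  rw [← coeff_expand_mul p hp f, h, coeff_expand_mul]

/-- The pairs of integers, split by the parity of the sum of the coordinates. -/
def parityEquiv : (ℤ × ℤ) ⊕ (ℤ × ℤ) ≃ ℤ × ℤ where
  toFun := Sum.elim (fun p => (p.1 + 1 + p.2, p.1 + 1 - p.2)) fun p => (p.1 + p.2 + 1, p.1 - p.2)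
  invFun p := if (p.1 + p.2) % 2 = 0 then Sum.inl ((p.1 + p.2) / 2 - 1, (p.1 - p.2) / 2)
    else Sum.inr ((p.1 + p.2 - 1) / 2, (p.1 - p.2 - 1) / 2)
  left_inv p := by
    rcases p with ⟨t, u⟩ | ⟨t, u⟩
    · change (if (t + 1 + u + (t + 1 - u)) % 2 = 0 then _ else _) = _
      rw [if_pos (by omega)]
      simp only [Sum.elim_inl]
      congr 2 <;> omega
    · change (if (t + u + 1 + (t - u)) % 2 = 0 then _ else _) = _
      rw [if_neg (by omega)]
      simp only [Sum.elim_inr]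
      congr 2 <;> omega
  right_inv p := by
    rcases p with ⟨m, n⟩
    by_cases h : (m + n) % 2 = 0
    · simp only [if_pos h, Sum.elim_inl]
      ext <;> simp only <;> omega
    · simp only [if_neg h, Sum.elim_inr]
      ext <;> simp only <;> omega

theorem hasSum_of_parity {f g g' : ℤ × ℤ → PowerSeries ℚ} {a b : PowerSeries ℚ}
    (hg : HasSum g a) (hg' : HasSum g' b)
    (h : ∀ t u, f (t + 1 + u, t + 1 - u) = g (t, u))
    (h' : ∀ t u, f (t + u + 1, t - u) = g' (t, u)) : HasSum f (a + b) := by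
  have e : f ∘ parityEquiv ∘ Sum.inl = g := funext fun p => h p.1 p.2
  have e' : f ∘ parityEquiv ∘ Sum.inr = g' := funext fun p => h' p.1 p.2
  rw [← e] at hg
  rw [← e'] at hg'
  rw [← parityEquiv.hasSum_iff]
  exact HasSum.sum hg hg'

theorem signSeries_two_mul (m : ℤ) : signSeries (2 * m) = 1 := by
  rw [two_mul, signSeries_add, signSeries_mul_self]

theorem X_pow_mul_expand_theta_mul_theta {N p r : ℕ} {A B : ℤ} (hp : 0 < p) (hpN : p < N)
    (hr : 0 < r) (hrN : r < N) (h4 : 4 * N ≠ 0) (hA : A = p + r) (hB : B = p - r) :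
    X ^ (A.natAbs ^ 2 + B.natAbs ^ 2 + N ^ 2) *
      expand (4 * N) h4 ((eulerProd N * theta p N) * (eulerProd N * theta r N)) =
    X ^ (2 * N * (p + r)) * sqBracket N A B := by
  have hN : 0 < N := hp.trans hpN
  have hL := (hasSum_expand (hasSum_mul_X_pow_mul (finite_thetaExp_le hp hpN)
    (finite_thetaExp_le hr hrN) (hasSum_theta hp hpN) (hasSum_theta hr hrN)) (4 * N) h4).mul_left
    (X ^ (A.natAbs ^ 2 + B.natAbs ^ 2 + N ^ 2))
  refine hL.unique ?_
  have hR : X ^ (2 * N * (p + r)) * sqBracket N A B =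
      X ^ (2 * N * (p + r)) * (sqSeries N 1 A * sqSeries N 0 B) +
        X ^ (2 * N * (p + r)) * -(sqSeries N 0 A * sqSeries N 1 B) := by
    rw [sqBracket]; ring
  rw [hR]
  have hexp : ∀ m n x y : ℤ, x = N * (m + n - 1) + A → y = N * (m - n) + B →
      A.natAbs ^ 2 + B.natAbs ^ 2 + N ^ 2 +
        4 * N * (thetaExp N p m + thetaExp N r n) =
      2 * N * (p + r) + (x.natAbs ^ 2 + y.natAbs ^ 2) := by
    rintro m n x y rfl rfl
    have h1 := two_mul_thetaExp hp hpN m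
    have h2 := two_mul_thetaExp hr hrN n
    zify
    simp only [sq_abs]
    rw [hA, hB]
    linear_combination (2 * N : ℤ) * h1 + 2 * N * h2
  have hsign : ∀ t u : ℤ, signSeries (t + 1 + u) * signSeries (t + 1 - u) = 1 := fun t u => by
    rw [← signSeries_add, ← signSeries_two_mul (t + 1)]; congr 1; ring
  have hsign' : ∀ t u : ℤ, signSeries (t + u + 1) * signSeries (t - u) = -1 := fun t u => by
    rw [← signSeries_add, show t + u + 1 + (t - u) = 2 * t + (1 : ℕ) by push_cast; ring,
      signSeries_add, signSeries_two_mul, signSeries_natCast]; ring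
  have h1 := (hasSum_sqSeries_mul hN 1 0 A B).mul_left (X ^ (2 * N * (p + r)))
  have h2 := ((hasSum_sqSeries_mul hN 0 1 A B).neg).mul_left (X ^ (2 * N * (p + r)))
  refine hasSum_of_parity h1 h2 (fun t u => ?_) fun t u => ?_
  · change _ * expand (4 * N) h4 (signSeries (t + 1 + u) * signSeries (t + 1 - u) *
      X ^ (thetaExp N p (t + 1 + u) + thetaExp N r (t + 1 - u))) = _
    rw [hsign, one_mul, map_pow, expand_X, ← pow_mul, ← pow_add, ← pow_add,
      hexp _ _ (N * (2 * t + 1) + A) (N * (2 * u + 0) + B) (by ring) (by ring)]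
  · change _ * expand (4 * N) h4 (signSeries (t + u + 1) * signSeries (t - u) *
      X ^ (thetaExp N p (t + u + 1) + thetaExp N r (t - u))) = _
    rw [hsign', neg_one_mul, map_neg, map_pow, expand_X, ← pow_mul, mul_neg, mul_neg, ← pow_add,
      ← pow_add, hexp _ _ (N * (2 * t + 0) + A) (N * (2 * u + 1) + B) (by ring) (by ring)]

end SquareSeries

theorem theta_reflect {j N : ℕ} (h : j ≤ N) : theta (N - j) N = theta j N := by
  rw [theta, theta, Nat.sub_sub_self h, mul_comm]

theorem theta_ne_zero {j N : ℕ} (hj : 0 < j) (hjN : j < N) : theta j N ≠ 0 :=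
  mul_ne_zero (tprod_one_sub_ne_zero hj (hj.trans hjN))
    (tprod_one_sub_ne_zero (Nat.sub_pos_of_lt hjN) (hj.trans hjN))

theorem theta_weierstrass {a b c k N : ℕ} (hk : k = a + b + c) (hN : N = 3 * k)
    (ha : 0 < a) (hb : 0 < b) (hc : 0 < c) :
    theta (k + a) N * theta (k + b) N * theta c N =
      theta (k + a + b) N * theta (a + c) N * theta (b + c) N -
        (X : PowerSeries ℚ) ^ c * (theta (a + b) N * theta a N * theta b N) := by
  have h4 : 4 * N ≠ 0 := by omega
  have t : theta (2 * k) N = theta k N := by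
    rw [← theta_reflect (by omega : k ≤ N)]; congr 1; omega
  have hE := eulerProd_ne_zero (N := N) (by omega)
  have hT := theta_ne_zero (by omega : 0 < k) (by omega : k < N)
  refine mul_left_cancel₀ (mul_ne_zero (pow_ne_zero 4 hE) hT) (expand_injective _ h4 ?_)
  obtain ⟨w, hw⟩ : ∃ w : ℤ, w = 2 * k + a + b := ⟨_, rfl⟩
  obtain ⟨x, hx⟩ : ∃ x : ℤ, x = a - b := ⟨_, rfl⟩
  obtain ⟨y, hy⟩ : ∃ y : ℤ, y = k + c := ⟨_, rfl⟩
  obtain ⟨z, hz⟩ : ∃ z : ℤ, z = a + b := ⟨_, rfl⟩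
  have A1 := X_pow_mul_expand_theta_mul_theta (N := N) (p := k + a) (r := k + b) (A := w) (B := x)
    (by omega) (by omega) (by omega) (by omega) h4 (by omega) (by omega)
  have A2 := X_pow_mul_expand_theta_mul_theta (N := N) (p := k) (r := c) (A := y) (B := z)
    (by omega) (by omega) (by omega) (by omega) h4 (by omega) (by omega)
  have B1 := X_pow_mul_expand_theta_mul_theta (N := N) (p := a + c) (r := b + c) (A := y) (B := x)
    (by omega) (by omega) (by omega) (by omega) h4 (by omega) (by omega)
  have B2 := X_pow_mul_expand_theta_mul_theta (N := N) (p := k + a + b) (r := k) (A := w) (B := z)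
    (by omega) (by omega) (by omega) (by omega) h4 (by omega) (by omega)
  have C1 := X_pow_mul_expand_theta_mul_theta (N := N) (p := 2 * k) (r := a + b) (A := w) (B := y)
    (by omega) (by omega) (by omega) (by omega) h4 (by omega) (by omega)
  have C2 := X_pow_mul_expand_theta_mul_theta (N := N) (p := a) (r := b) (A := z) (B := x)
    (by omega) (by omega) (by omega) (by omega) h4 (by omega) (by omega)
  have pl := sqBracket_plucker N w x y z
  rw [t] at C1
  have hX : (X : PowerSeries ℚ) ^ (w.natAbs ^ 2 + x.natAbs ^ 2 + N ^ 2 +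
      (y.natAbs ^ 2 + z.natAbs ^ 2 + N ^ 2)) ≠ 0 := pow_ne_zero _ X_ne_zero
  refine mul_left_cancel₀ hX ?_
  have M1 := congrArg₂ (· * ·) A1 A2
  have M2 := congrArg₂ (· * ·) B1 B2
  have M3 := congrArg₂ (· * ·) C1 C2
  simp only [map_mul, map_sub, map_pow, expand_X] at M1 M2 M3 ⊢
  subst hk
  linear_combination M1 - M2 + X ^ (4 * N * c) * M3 +
    X ^ (2 * N * (3 * a + 3 * b + 2 * c + (a + b + 2 * c))) * pl

/-- Theorem `thm:weier_a2_rel` (`eqn:mod3kqrel`): for `k ≥ 3` and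
`c₀ ≥ c₁ ≥ c₂ ≥ 0` with `c₀ + c₁ + c₂ = 3k − 3` and `c₁ ≥ k`:
`θ(q^{c₀+1};q^{3k}) θ(q^{c₁+1};q^{3k}) θ(q^{c₂+1};q^{3k})
  = θ(q^{2k−c₂−1};q^{3k}) θ(q^{2k−c₁−1};q^{3k}) θ(q^{2k−c₀−1};q^{3k})
    − q^{c₂+1} θ(q^{2k+c₂+1};q^{3k}) θ(q^{c₀−k+1};q^{3k}) θ(q^{c₁−k+1};q^{3k})`. -/
theorem statement6 (k c₀ c₁ c₂ : ℕ) (hk : 3 ≤ k)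
    (h01 : c₁ ≤ c₀) (h12 : c₂ ≤ c₁)
    (hsum : c₀ + c₁ + c₂ = 3 * k - 3) (hc1 : k ≤ c₁) :
    theta (c₀ + 1) (3 * k) * theta (c₁ + 1) (3 * k) * theta (c₂ + 1) (3 * k)
      = theta (2 * k - c₂ - 1) (3 * k) * theta (2 * k - c₁ - 1) (3 * k) *
          theta (2 * k - c₀ - 1) (3 * k) -
        (X : PowerSeries ℚ) ^ (c₂ + 1) *
          (theta (2 * k + c₂ + 1) (3 * k) * theta (c₀ - k + 1) (3 * k) *
            theta (c₁ - k + 1) (3 * k)) := by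
  have h := theta_weierstrass (a := c₀ - k + 1) (b := c₁ - k + 1) (c := c₂ + 1) (k := k)
    (N := 3 * k) (by omega) rfl (by omega) (by omega) (by omega)
  rw [← theta_reflect (by omega : 2 * k + c₂ + 1 ≤ 3 * k),
    show 3 * k - (2 * k + c₂ + 1) = c₀ - k + 1 + (c₁ - k + 1) by omega,
    show 2 * k - c₂ - 1 = k + (c₀ - k + 1) + (c₁ - k + 1) by omega,
    show 2 * k - c₁ - 1 = c₀ - k + 1 + (c₂ + 1) by omega,
    show 2 * k - c₀ - 1 = c₁ - k + 1 + (c₂ + 1) by omega,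
    show c₀ + 1 = k + (c₀ - k + 1) by omega, show c₁ + 1 = k + (c₁ - k + 1) by omega]
  exact h
end
end
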